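/- For L, L' ∈ ℤ*, the following are equivalent: (1) L ~ L'; (2) hodge(L) = hodge(L'), det(L) = det(L'), and Subbar(L) = Subbar(L'). -/

import Mathlib

/-- `Y` is a blowing-up of the finite integer sequence `X`. -/
inductive SeqBlowup : List ℤ → List ℤ → Prop
  | empty : SeqBlowup [] [-1]
  | left (x : ℤ) (l : List ℤ) : SeqBlowup (x :: l) (-1 :: (x - 1) :: l)
  | mid (A B : List ℤ) (a b : ℤ) :
      SeqBlowup (A ++ a :: b :: B) (A ++ (a - 1) :: -1 :: (b - 1) :: B)
  | right (l : List ℤ) (x : ℤ) : SeqBlowup (l ++ [x]) (l ++ [x - 1, -1])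

/-- Two sequences are equivalent if one is obtained from the other by a finite
sequence of blowings-up and blowings-down. -/
def SeqEquiv (X Y : List ℤ) : Prop := Relation.EqvGen SeqBlowup X Y

/-- The determinant of the matrix `-M(X)`, where `M(X)` is the intersection matrix of
the sequence `X` (diagonal `xᵢ`, `1` on the off-diagonals `|i-j| = 1`); `det(∅) = 1`. -/
def seqDet : List ℤ → ℤ
  | [] => 1
  | [x] => -x
  | x :: y :: l => -x * seqDet (y :: l) - seqDet l

/-- `det₁(x₁,…,xₙ) = det(x₂,…,xₙ)`, with `det₁(∅) = 0`. -/
def seqDet1 : List ℤ → ℤ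
  | [] => 0
  | _ :: l => seqDet l

/-- The intersection form of the sequence `X`: the symmetric bilinear form on `ℝⁿ`
(`n = length of X`) whose matrix has `xᵢ` on the diagonal and `1` in positions
`(i,j)` with `|i-j| = 1`, evaluated at `(v, v)`. -/
noncomputable def seqForm (X : List ℤ) (v : Fin X.length → ℝ) : ℝ :=
  ∑ i, ∑ j, v i * (if i = j then ((X.get i : ℤ) : ℝ)
    else if i.val + 1 = j.val ∨ j.val + 1 = i.val then 1 else 0) * v j

/-- `hodge(X)`: the maximal dimension of a linear subspace of `ℝⁿ` on which the
intersection form of `X` is nonnegative. -/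
noncomputable def seqHodge (X : List ℤ) : ℕ :=
  sSup { k | ∃ W : Submodule ℝ (Fin X.length → ℝ),
      Module.finrank ℝ W = k ∧ ∀ v ∈ W, 0 ≤ seqForm X v }

section Determinants

theorem seqDet_cons (x : ℤ) (l : List ℤ) : seqDet (x :: l) = -x * seqDet l - seqDet1 l := by
  cases l <;> simp [seqDet, seqDet1]

@[simp] theorem seqDet_nil : seqDet [] = 1 := rfl

@[simp] theorem seqDet1_nil : seqDet1 [] = 0 := rfl

@[simp] theorem seqDet1_cons (x : ℤ) (l : List ℤ) : seqDet1 (x :: l) = seqDet l := rfl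

/-- The pair `(seqDet, seqDet1)` of `A ++ P` depends linearly on that of `P`. -/
theorem seqDet_append_linear {P Q R : List ℤ} {a b : ℤ}
    (h : seqDet P = a * seqDet Q + b * seqDet R)
    (h' : seqDet1 P = a * seqDet1 Q + b * seqDet1 R) (A : List ℤ) :
    seqDet (A ++ P) = a * seqDet (A ++ Q) + b * seqDet (A ++ R) ∧
      seqDet1 (A ++ P) = a * seqDet1 (A ++ Q) + b * seqDet1 (A ++ R) := by
  induction A with
  | nil => exact ⟨h, h'⟩
  | cons x A ih =>
    simp only [List.cons_append, seqDet_cons, seqDet1_cons]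
    refine ⟨?_, ih.1⟩
    rw [ih.1, ih.2]
    ring

theorem seqDet_append_congr {P Q : List ℤ} (h : seqDet P = seqDet Q)
    (h' : seqDet1 P = seqDet1 Q) (A : List ℤ) :
    seqDet (A ++ P) = seqDet (A ++ Q) ∧ seqDet1 (A ++ P) = seqDet1 (A ++ Q) := by
  simpa using seqDet_append_linear (R := []) (a := 1) (b := 0) (by simpa using h)
    (by simpa using h') A

theorem seqDet_append_pair (l : List ℤ) (y x : ℤ) :
    seqDet (l ++ [y, x]) = -x * seqDet (l ++ [y]) - seqDet l := by
  have := (seqDet_append_linear (P := [y, x]) (Q := [y]) (R := []) (a := -x) (b := -1)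
    (by simp [seqDet_cons]; ring) (by simp [seqDet_cons]) l).1
  rw [this, List.append_nil]
  ring

theorem seqDet_reverse (l : List ℤ) : seqDet l.reverse = seqDet l := by
  induction l using seqDet.induct with
  | case1 => rfl
  | case2 x => rfl
  | case3 x y l ih₁ ih₂ =>
    have h : (x :: y :: l).reverse = l.reverse ++ [y, x] := by simp
    rw [h, seqDet_append_pair, ← List.reverse_cons, ih₁, ih₂, seqDet]

theorem SeqBlowup.reverse {X Y : List ℤ} (h : SeqBlowup X Y) :
    SeqBlowup X.reverse Y.reverse := by
  cases h with
  | empty => exact .empty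
  | left x l => simpa using SeqBlowup.right l.reverse x
  | mid A B a b => simpa using SeqBlowup.mid B.reverse A.reverse b a
  | right l x => simpa using SeqBlowup.left x l.reverse

theorem SeqBlowup.seqDet_eq {X Y : List ℤ} (h : SeqBlowup X Y) :
    seqDet X = seqDet Y ∧ seqDet1 X ≡ seqDet1 Y [ZMOD seqDet X] := by
  cases h with
  | empty => simp [seqDet_cons, Int.modEq_one]
  | left x l =>
    refine ⟨by simp only [seqDet_cons, seqDet1_cons]; ring, ?_⟩
    refine (Int.modEq_iff_dvd).2 ⟨1, ?_⟩
    simp only [seqDet_cons, seqDet1_cons]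
    ring
  | mid A B a b =>
    have := seqDet_append_congr (P := a :: b :: B) (Q := (a - 1) :: -1 :: (b - 1) :: B)
      (by simp only [seqDet_cons, seqDet1_cons]; ring)
      (by simp only [seqDet_cons, seqDet1_cons]; ring) A
    exact ⟨this.1, by rw [this.2]⟩
  | right l x =>
    have := seqDet_append_congr (P := [x]) (Q := [x - 1, -1])
      (by simp [seqDet_cons]) (by simp [seqDet_cons]) l
    exact ⟨this.1, by rw [this.2]⟩

theorem SeqBlowup.seqDet1_reverse_modEq {X Y : List ℤ} (h : SeqBlowup X Y) :
    seqDet1 X.reverse ≡ seqDet1 Y.reverse [ZMOD seqDet X] := by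
  simpa [seqDet_reverse] using h.reverse.seqDet_eq.2

theorem seqDet_zero_zero (A : List ℤ) :
    seqDet (0 :: 0 :: A) = -seqDet A ∧ seqDet1 (0 :: 0 :: A) = -seqDet1 A ∧
      seqDet1 (0 :: 0 :: A).reverse = -seqDet1 A.reverse := by
  refine ⟨by simp [seqDet_cons], by simp [seqDet_cons], ?_⟩
  have h := (seqDet_append_linear (P := [0, 0]) (Q := []) (R := []) (a := -1) (b := 0)
    (by simp [seqDet_cons]) (by simp [seqDet_cons]) A.reverse).2
  simpa using h

/-- In a sequence with all terms at most `-2`, the determinants decrease. -/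
theorem seqDet1_lt_seqDet {A : List ℤ} (hA : ∀ x ∈ A, x ≤ -2) :
    0 ≤ seqDet1 A ∧ seqDet1 A < seqDet A := by
  induction A with
  | nil => simp
  | cons x l ih =>
    obtain ⟨h₀, h₁⟩ := ih fun y hy => hA y (List.mem_cons_of_mem _ hy)
    have hx := hA x List.mem_cons_self
    rw [seqDet_cons, seqDet1_cons]
    constructor <;> nlinarith

theorem eq_of_seqDet_eq {A B : List ℤ} (hA : ∀ x ∈ A, x ≤ -2) (hB : ∀ x ∈ B, x ≤ -2)
    (h : seqDet A = seqDet B) (h₁ : seqDet1 A = seqDet1 B) : A = B := by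
  induction A generalizing B with
  | nil =>
    cases B with
    | nil => rfl
    | cons y m =>
      have := seqDet1_lt_seqDet fun z hz => hB z (List.mem_cons_of_mem _ hz)
      simp only [seqDet1_nil, seqDet1_cons] at h₁
      omega
  | cons x l ih =>
    have hl := seqDet1_lt_seqDet fun z hz => hA z (List.mem_cons_of_mem _ hz)
    cases B with
    | nil =>
      simp only [seqDet1_nil, seqDet1_cons] at h₁
      omega
    | cons y m =>
      have hm := seqDet1_lt_seqDet fun z hz => hB z (List.mem_cons_of_mem _ hz)
      simp only [seqDet_cons, seqDet1_cons] at h h₁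
      rw [← h₁] at h hm
      have hxy : x = y := by
        rcases lt_trichotomy x y with hlt | heq | hlt
        · nlinarith
        · exact heq
        · nlinarith
      subst hxy
      rw [ih (fun z hz => hA z (List.mem_cons_of_mem _ hz))
        (fun z hz => hB z (List.mem_cons_of_mem _ hz)) h₁ (by linarith)]

end Determinants

section Index

variable {V V' : Type*} [AddCommGroup V] [Module ℝ V] [AddCommGroup V'] [Module ℝ V']

/-- The maximal dimension of a linear subspace on which `Q` is nonnegative. -/
noncomputable def nonnegIndex (Q : V → ℝ) : ℕ :=
  sSup {k | ∃ W : Submodule ℝ V, Module.finrank ℝ W = k ∧ ∀ v ∈ W, 0 ≤ Q v}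

theorem finrank_le_nonnegIndex [FiniteDimensional ℝ V] {Q : V → ℝ} (W : Submodule ℝ V)
    (hW : ∀ v ∈ W, 0 ≤ Q v) : Module.finrank ℝ W ≤ nonnegIndex Q := by
  refine le_csSup ⟨Module.finrank ℝ V, ?_⟩ ⟨W, rfl, hW⟩
  rintro _ ⟨U, rfl, -⟩
  exact U.finrank_le

theorem nonnegIndex_le {Q : V → ℝ} {n : ℕ}
    (h : ∀ W : Submodule ℝ V, (∀ v ∈ W, 0 ≤ Q v) → Module.finrank ℝ W ≤ n) :
    nonnegIndex Q ≤ n := by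
  refine csSup_le' ?_
  rintro _ ⟨W, rfl, hW⟩
  exact h W hW

/-- A linear map that preserves nonnegative vectors and kills none but `0` does not decrease
the index. -/
theorem nonnegIndex_le_of_linearMap [FiniteDimensional ℝ V] [FiniteDimensional ℝ V']
    {Q : V → ℝ} {Q' : V' → ℝ} (f : V →ₗ[ℝ] V') (hf : ∀ v, 0 ≤ Q v → 0 ≤ Q' (f v))
    (hinj : ∀ v, 0 ≤ Q v → f v = 0 → v = 0) : nonnegIndex Q ≤ nonnegIndex Q' := by
  refine nonnegIndex_le fun W hW => ?_
  have hker : Function.Injective (f.domRestrict W) := by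
    rw [← LinearMap.ker_eq_bot, LinearMap.ker_eq_bot']
    rintro ⟨v, hv⟩ h
    exact Subtype.ext (hinj v (hW v hv) h)
  rw [← LinearMap.finrank_range_of_inj hker]
  refine finrank_le_nonnegIndex _ ?_
  rintro _ ⟨⟨v, hv⟩, rfl⟩
  exact hf v (hW v hv)

theorem nonnegIndex_congr [FiniteDimensional ℝ V] [FiniteDimensional ℝ V']
    {Q : V → ℝ} {Q' : V' → ℝ} (e : V ≃ₗ[ℝ] V') (h : ∀ v, Q' (e v) = Q v) :
    nonnegIndex Q' = nonnegIndex Q := by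
  refine le_antisymm ?_ ?_
  · refine nonnegIndex_le_of_linearMap e.symm.toLinearMap (fun v hv => ?_) (by simp)
    simpa [← h] using hv
  · exact nonnegIndex_le_of_linearMap e.toLinearMap (fun v hv => by simpa [h] using hv) (by simp)

theorem nonnegIndex_sub_sq [FiniteDimensional ℝ V] {Q : V → ℝ} (h0 : Q 0 = 0) :
    nonnegIndex (fun p : V × ℝ => Q p.1 - p.2 ^ 2) = nonnegIndex Q := by
  refine le_antisymm ?_ ?_
  · refine nonnegIndex_le_of_linearMap (LinearMap.fst ℝ V ℝ) (fun v hv => ?_) ?_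
    · simp only [LinearMap.fst_apply]
      nlinarith [sq_nonneg v.2]
    · rintro ⟨v, u⟩ hv h
      simp only [LinearMap.fst_apply] at h
      subst h
      have : u ^ 2 = 0 := le_antisymm (by simp only [h0] at hv; linarith) (sq_nonneg u)
      simp [pow_eq_zero_iff two_ne_zero |>.1 this]
  · exact nonnegIndex_le_of_linearMap (LinearMap.inl ℝ V ℝ) (by simp) (by simp)

theorem exists_finrank_eq_nonnegIndex [FiniteDimensional ℝ V] {Q : V → ℝ} (h0 : Q 0 = 0) :
    ∃ W : Submodule ℝ V, Module.finrank ℝ W = nonnegIndex Q ∧ ∀ v ∈ W, 0 ≤ Q v := by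
  refine Nat.sSup_mem (s := {k | ∃ W : Submodule ℝ V,
    Module.finrank ℝ W = k ∧ ∀ v ∈ W, 0 ≤ Q v}) ⟨0, ⊥, by simp, ?_⟩ ⟨Module.finrank ℝ V, ?_⟩
  · intro v hv
    rw [(Submodule.mem_bot ℝ).1 hv, h0]
  · rintro _ ⟨U, rfl, -⟩
    exact U.finrank_le

theorem nonnegIndex_add_sq [FiniteDimensional ℝ V] {Q : V → ℝ} (h0 : Q 0 = 0) :
    nonnegIndex (fun p : V × ℝ => Q p.1 + p.2 ^ 2) = nonnegIndex Q + 1 := by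
  refine le_antisymm (nonnegIndex_le fun W hW => ?_) ?_
  · set g := (LinearMap.snd ℝ V ℝ).domRestrict W
    have hrange : Module.finrank ℝ (LinearMap.range g) ≤ 1 := by
      simpa using (LinearMap.range g).finrank_le
    have hker : Module.finrank ℝ (LinearMap.ker g) ≤ nonnegIndex Q := by
      set f : LinearMap.ker g →ₗ[ℝ] V :=
        ((LinearMap.fst ℝ V ℝ).domRestrict W).domRestrict (LinearMap.ker g)
      have hf : Function.Injective f := by
        rintro ⟨⟨p, hp⟩, hpg⟩ ⟨⟨q, hq⟩, hqg⟩ h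
        have hpq : p.2 = q.2 := hpg.trans hqg.symm
        exact Subtype.ext (Subtype.ext (Prod.ext h hpq))
      rw [← LinearMap.finrank_range_of_inj hf]
      refine finrank_le_nonnegIndex _ ?_
      rintro _ ⟨⟨⟨p, hp⟩, hpg⟩, rfl⟩
      have h2 : p.2 = 0 := hpg
      have := hW p hp
      rw [h2] at this
      change 0 ≤ Q p.1
      linarith
    have := LinearMap.finrank_range_add_finrank_ker g
    omega
  · obtain ⟨W, hWk, hW⟩ := exists_finrank_eq_nonnegIndex h0
    set f : W × ℝ →ₗ[ℝ] V × ℝ := W.subtype.prodMap LinearMap.id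
    have hf : Function.Injective f := W.injective_subtype.prodMap Function.injective_id
    have h := finrank_le_nonnegIndex (Q := fun p : V × ℝ => Q p.1 + p.2 ^ 2) (LinearMap.range f)
      (by rintro _ ⟨p, rfl⟩; exact add_nonneg (hW _ p.1.2) (sq_nonneg _))
    rw [LinearMap.finrank_range_of_inj hf, Module.finrank_prod, Module.finrank_self, hWk] at h
    exact h

end Index

section Form

/-- The first coordinate of a vector, or `0` if there is none. -/
noncomputable def headCoord : {n : ℕ} → (Fin n → ℝ) → ℝ
  | 0, _ => 0
  | _ + 1, v => v 0

theorem headCoord_eq_sum {n : ℕ} (v : Fin n → ℝ) :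
    headCoord v = ∑ j, (if j.val = 0 then 1 else 0) * v j := by
  cases n with
  | zero => simp [headCoord]
  | succ n => simp [headCoord]

theorem headCoord_add {n : ℕ} (v w : Fin n → ℝ) :
    headCoord (v + w) = headCoord v + headCoord w := by
  cases n <;> simp [headCoord]

theorem headCoord_smul {n : ℕ} (c : ℝ) (v : Fin n → ℝ) :
    headCoord (c • v) = c * headCoord v := by
  cases n <;> simp [headCoord]

@[simp] theorem seqForm_zero (X : List ℤ) : seqForm X 0 = 0 := by simp [seqForm]

theorem seqForm_nil (v : Fin ([] : List ℤ).length → ℝ) : seqForm [] v = 0 := by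
  simp [seqForm]

/-- The entries of the intersection matrix. -/
noncomputable def seqCoeff (X : List ℤ) (i j : Fin X.length) : ℝ :=
  if i = j then ((X.get i : ℤ) : ℝ)
    else if i.val + 1 = j.val ∨ j.val + 1 = i.val then 1 else 0

theorem seqForm_eq_sum_seqCoeff (X : List ℤ) (v : Fin X.length → ℝ) :
    seqForm X v = ∑ i, ∑ j, v i * seqCoeff X i j * v j := rfl

theorem seqForm_cons (x : ℤ) (l : List ℤ) (v : Fin (l.length + 1) → ℝ) :
    seqForm (x :: l) v =
      x * v 0 ^ 2 + 2 * v 0 * headCoord (Fin.tail v) + seqForm l (Fin.tail v) := by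
  have h00 : seqCoeff (x :: l) (0 : Fin (l.length + 1)) (0 : Fin (l.length + 1)) = x := rfl
  have h0s : ∀ j : Fin l.length, seqCoeff (x :: l) (0 : Fin (l.length + 1)) j.succ =
      if j.val = 0 then 1 else 0 := fun j => by
    simp [seqCoeff, Fin.ext_iff, eq_comm]
  have hs0 : ∀ j : Fin l.length, seqCoeff (x :: l) j.succ (0 : Fin (l.length + 1)) =
      if j.val = 0 then 1 else 0 := fun j => by
    simp [seqCoeff, Fin.ext_iff, eq_comm]
  have hss : ∀ i j : Fin l.length, seqCoeff (x :: l) i.succ j.succ = seqCoeff l i j :=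
    fun i j => by simp [seqCoeff, Fin.ext_iff]
  rw [headCoord_eq_sum, seqForm_eq_sum_seqCoeff, seqForm_eq_sum_seqCoeff]
  change ∑ i : Fin (l.length + 1), ∑ j : Fin (l.length + 1), _ = _
  simp only [Fin.sum_univ_succ (n := l.length), h00, h0s, hs0, hss, Finset.sum_add_distrib,
    Fin.tail, Finset.mul_sum]
  have e1 : ∀ j : Fin l.length, v 0 * (if j.val = 0 then 1 else 0) * v j.succ +
      v j.succ * (if j.val = 0 then 1 else 0) * v 0 =
      2 * v 0 * ((if j.val = 0 then 1 else 0) * v j.succ) := fun j => by ring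
  simp only [← e1, Finset.sum_add_distrib]
  ring

theorem seqHodge_eq_nonnegIndex (X : List ℤ) : seqHodge X = nonnegIndex (seqForm X) := rfl

/-- The form of `Y` is isometric to the orthogonal sum of the form of `X` and `⟨-1⟩`. -/
def IsFormExtension (X Y : List ℤ) : Prop :=
  ∃ e : ((Fin X.length → ℝ) × ℝ) ≃ₗ[ℝ] (Fin Y.length → ℝ),
    ∀ p, seqForm Y (e p) = seqForm X p.1 - p.2 ^ 2

/-- As `IsFormExtension`, with an isometry that keeps the first coordinate. -/
def IsHeadFormExtension (X Y : List ℤ) : Prop :=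
  ∃ e : ((Fin X.length → ℝ) × ℝ) ≃ₗ[ℝ] (Fin Y.length → ℝ),
    ∀ p, headCoord (e p) = headCoord p.1 ∧ seqForm Y (e p) = seqForm X p.1 - p.2 ^ 2

theorem IsFormExtension.seqHodge_eq {X Y : List ℤ} (h : IsFormExtension X Y) :
    seqHodge X = seqHodge Y := by
  obtain ⟨e, he⟩ := h
  rw [seqHodge_eq_nonnegIndex, seqHodge_eq_nonnegIndex, nonnegIndex_congr e he,
    nonnegIndex_sub_sq (seqForm_zero X)]

theorem IsHeadFormExtension.isFormExtension {X Y : List ℤ} (h : IsHeadFormExtension X Y) :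
    IsFormExtension X Y :=
  let ⟨e, he⟩ := h
  ⟨e, fun p => (he p).2⟩

theorem IsHeadFormExtension.cons {X Y : List ℤ} (x : ℤ) (h : IsHeadFormExtension X Y) :
    IsHeadFormExtension (x :: X) (x :: Y) := by
  obtain ⟨e, he⟩ := h
  let e' : ((Fin (X.length + 1) → ℝ) × ℝ) ≃ₗ[ℝ] (Fin (Y.length + 1) → ℝ) :=
    ((Fin.consLinearEquiv ℝ fun _ : Fin (X.length + 1) => ℝ).symm.prodCongr
      (LinearEquiv.refl ℝ ℝ)).trans <|
    (LinearEquiv.prodAssoc ℝ ℝ (Fin X.length → ℝ) ℝ).trans <|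
    ((LinearEquiv.refl ℝ ℝ).prodCongr e).trans
      (Fin.consLinearEquiv ℝ fun _ : Fin (Y.length + 1) => ℝ)
  have he' : ∀ p, e' p = Fin.cons (p.1 0) (e (Fin.tail p.1, p.2)) := fun p => rfl
  refine ⟨e', fun p => ?_⟩
  have h2 := he (Fin.tail p.1, p.2)
  rw [he', seqForm_cons, seqForm_cons]
  refine ⟨rfl, ?_⟩
  rw [Fin.cons_zero, Fin.tail_cons, h2.1, h2.2]
  ring

/-- The substitution inserting a coordinate `m` after the first one, where
`m = v₀ + headCoord (tail v) + u`. -/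
theorem isHeadFormExtension_mid (a b : ℤ) (B : List ℤ) :
    IsHeadFormExtension (a :: b :: B) ((a - 1) :: -1 :: (b - 1) :: B) := by
  let e : ((Fin (B.length + 2) → ℝ) × ℝ) ≃ₗ[ℝ] (Fin (B.length + 3) → ℝ) :=
    { toFun := fun p => Fin.cons (p.1 0) (Fin.cons (p.1 0 + p.1 1 + p.2) (Fin.tail p.1))
      invFun := fun w => (Fin.cons (w 0) (Fin.tail (Fin.tail w)), w 1 - w 0 - w 2)
      map_add' := fun p q => by
        funext i
        refine Fin.cases ?_ (fun i => Fin.cases ?_ (fun i => ?_) i) i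
        · simp
        · simp
          ring
        · simp [Fin.tail]
      map_smul' := fun c p => by
        funext i
        refine Fin.cases ?_ (fun i => Fin.cases ?_ (fun i => ?_) i) i
        · simp
        · simp
          ring
        · simp [Fin.tail]
      left_inv := fun p => by
        refine Prod.ext ?_ ?_
        · simp only [Fin.cons_zero, Fin.tail_cons]
          exact Fin.cons_self_tail p.1
        · change p.1 0 + p.1 1 + p.2 - p.1 0 - p.1 1 = p.2
          ring
      right_inv := fun w => by
        funext i
        refine Fin.cases ?_ (fun i => Fin.cases ?_ (fun i => ?_) i) i
        · rfl
        · change w 0 + w 2 + (w 1 - w 0 - w 2) = w 1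
          ring
        · rfl }
  refine ⟨e, fun p => ⟨rfl, ?_⟩⟩
  have h1 := seqForm_cons (a - 1) (-1 :: (b - 1) :: B) (e p)
  have h2 := seqForm_cons (-1) ((b - 1) :: B) (Fin.tail (e p))
  have h3 := seqForm_cons (b - 1) B (Fin.tail (Fin.tail (e p)))
  have h4 := seqForm_cons a (b :: B) p.1
  have h5 := seqForm_cons b B (Fin.tail p.1)
  rw [h1, h2, h3, h4, h5]
  have t3 : Fin.tail (Fin.tail (Fin.tail (e p))) = Fin.tail (Fin.tail p.1) := rfl
  have e0 : e p 0 = p.1 0 := rfl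
  have e1 : Fin.tail (e p) 0 = p.1 0 + p.1 1 + p.2 := rfl
  have e2 : Fin.tail (Fin.tail (e p)) 0 = p.1 1 := rfl
  have e3 : Fin.tail p.1 0 = p.1 1 := rfl
  have k1 : headCoord (Fin.tail (e p)) = p.1 0 + p.1 1 + p.2 := rfl
  have k2 : headCoord (Fin.tail (Fin.tail (e p))) = p.1 1 := rfl
  have k3 : headCoord (Fin.tail p.1) = p.1 1 := rfl
  rw [t3, e0, e1, e2, e3, k1, k2, k3]
  push_cast
  ring

theorem isHeadFormExtension_right (x : ℤ) : IsHeadFormExtension [x] [x - 1, -1] := by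
  let e : ((Fin 1 → ℝ) × ℝ) ≃ₗ[ℝ] (Fin 2 → ℝ) :=
    { toFun := fun p => ![p.1 0, p.1 0 + p.2]
      invFun := fun w => (![w 0], w 1 - w 0)
      map_add' := fun p q => by
        funext i
        fin_cases i
        · simp
        · simp
          ring
      map_smul' := fun c p => by
        funext i
        fin_cases i <;> simp [mul_add]
      left_inv := fun p => by
        refine Prod.ext ?_ ?_
        · funext i
          fin_cases i
          rfl
        · simp
      right_inv := fun w => by
        funext i
        fin_cases i <;> simp }
  refine ⟨e, fun p => ⟨rfl, ?_⟩⟩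
  have h1 := seqForm_cons (x - 1) [-1] (e p)
  have h2 := seqForm_cons (-1) [] (Fin.tail (e p))
  have h3 := seqForm_cons x [] p.1
  rw [h1, h2, h3, seqForm_nil, seqForm_nil]
  have e0 : e p 0 = p.1 0 := rfl
  have e1 : Fin.tail (e p) 0 = p.1 0 + p.2 := rfl
  have k1 : headCoord (Fin.tail (e p)) = p.1 0 + p.2 := rfl
  have k2 : headCoord (Fin.tail (Fin.tail (e p))) = 0 := rfl
  have k3 : headCoord (Fin.tail p.1) = 0 := rfl
  rw [e0, e1, k1, k2, k3]
  push_cast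
  ring

theorem isFormExtension_left (x : ℤ) (l : List ℤ) :
    IsFormExtension (x :: l) (-1 :: (x - 1) :: l) := by
  let e : ((Fin (l.length + 1) → ℝ) × ℝ) ≃ₗ[ℝ] (Fin (l.length + 2) → ℝ) :=
    { toFun := fun p => Fin.cons (p.1 0 + p.2) p.1
      invFun := fun w => (Fin.tail w, w 0 - w 1)
      map_add' := fun p q => by
        funext i
        refine Fin.cases ?_ (fun i => ?_) i
        · simp
          ring
        · simp
      map_smul' := fun c p => by
        funext i
        refine Fin.cases ?_ (fun i => ?_) i <;> simp [mul_add]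
      left_inv := fun p => by
        refine Prod.ext rfl ?_
        change p.1 0 + p.2 - p.1 0 = p.2
        ring
      right_inv := fun w => by
        funext i
        refine Fin.cases ?_ (fun i => rfl) i
        change w 1 + (w 0 - w 1) = w 0
        ring }
  refine ⟨e, fun p => ?_⟩
  have h1 := seqForm_cons (-1) ((x - 1) :: l) (e p)
  have h2 := seqForm_cons (x - 1) l (Fin.tail (e p))
  have h3 := seqForm_cons x l p.1
  rw [h1, h2, h3]
  have t1 : Fin.tail (e p) = p.1 := rfl
  have e0 : e p 0 = p.1 0 + p.2 := rfl
  have k1 : headCoord p.1 = p.1 0 := rfl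
  rw [t1, e0, k1]
  push_cast
  ring

theorem isFormExtension_empty : IsFormExtension [] [-1] := by
  let e : ((Fin 0 → ℝ) × ℝ) ≃ₗ[ℝ] (Fin 1 → ℝ) :=
    { toFun := fun p => ![p.2]
      invFun := fun w => (![], w 0)
      map_add' := fun p q => by simp
      map_smul' := fun c p => by simp
      left_inv := fun p => Prod.ext (Subsingleton.elim _ _) rfl
      right_inv := fun w => by
        funext i
        fin_cases i
        rfl }
  refine ⟨e, fun p => ?_⟩
  have h1 := seqForm_cons (-1) [] (e p)
  have e0 : e p 0 = p.2 := rfl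
  have k1 : headCoord (Fin.tail (e p)) = 0 := rfl
  rw [h1, seqForm_nil, seqForm_nil, e0, k1]
  push_cast
  ring

theorem IsHeadFormExtension.append {X Y : List ℤ} (h : IsHeadFormExtension X Y) (A : List ℤ) :
    IsHeadFormExtension (A ++ X) (A ++ Y) := by
  induction A with
  | nil => exact h
  | cons x A ih => exact ih.cons x

theorem SeqBlowup.seqHodge_eq {X Y : List ℤ} (h : SeqBlowup X Y) : seqHodge X = seqHodge Y := by
  refine IsFormExtension.seqHodge_eq ?_
  cases h with
  | empty => exact isFormExtension_empty
  | left x l => exact isFormExtension_left x l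
  | mid A B a b => exact ((isHeadFormExtension_mid a b B).append A).isFormExtension
  | right l x => exact ((isHeadFormExtension_right x).append l).isFormExtension

theorem seqHodge_zero_zero (A : List ℤ) : seqHodge (0 :: 0 :: A) = seqHodge A + 1 := by
  let n := A.length
  let e : (((Fin n → ℝ) × ℝ) × ℝ) ≃ₗ[ℝ] (Fin (n + 2) → ℝ) :=
    { toFun := fun p => Fin.cons ((p.2 + p.1.2) / 2 - headCoord p.1.1)
        (Fin.cons (p.2 - p.1.2) p.1.1)
      invFun := fun w =>
        ((Fin.tail (Fin.tail w), w 0 + headCoord (Fin.tail (Fin.tail w)) - w 1 / 2),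
        w 0 + headCoord (Fin.tail (Fin.tail w)) + w 1 / 2)
      map_add' := fun p q => by
        funext i
        refine Fin.cases ?_ (fun i => Fin.cases ?_ (fun i => ?_) i) i
        · simp [headCoord_add]
          ring
        · simp
          ring
        · simp
      map_smul' := fun c p => by
        funext i
        refine Fin.cases ?_ (fun i => Fin.cases ?_ (fun i => ?_) i) i
        · simp [headCoord_smul]
          ring
        · simp
          ring
        · simp
      left_inv := fun p => by
        refine Prod.ext (Prod.ext rfl ?_) ?_
        · change (p.2 + p.1.2) / 2 - headCoord p.1.1 + headCoord p.1.1 - (p.2 - p.1.2) / 2 = p.1.2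
          ring
        · change (p.2 + p.1.2) / 2 - headCoord p.1.1 + headCoord p.1.1 + (p.2 - p.1.2) / 2 = p.2
          ring
      right_inv := fun w => by
        funext i
        refine Fin.cases ?_ (fun i => Fin.cases ?_ (fun i => rfl) i) i <;> simp }
  have he : ∀ p, seqForm (0 :: 0 :: A) (e p) = seqForm A p.1.1 - p.1.2 ^ 2 + p.2 ^ 2 := fun p => by
    have h1 := seqForm_cons 0 (0 :: A) (e p)
    have h2 := seqForm_cons 0 A (Fin.tail (e p))
    have t2 : Fin.tail (Fin.tail (e p)) = p.1.1 := rfl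
    have e0 : e p 0 = (p.2 + p.1.2) / 2 - headCoord p.1.1 := rfl
    have e1 : Fin.tail (e p) 0 = p.2 - p.1.2 := rfl
    have k1 : headCoord (Fin.tail (e p)) = p.2 - p.1.2 := rfl
    rw [h1, h2, t2, e0, e1, k1]
    push_cast
    ring
  rw [seqHodge_eq_nonnegIndex, nonnegIndex_congr e he,
    nonnegIndex_add_sq (Q := fun p : (Fin n → ℝ) × ℝ => seqForm A p.1 - p.2 ^ 2)
      (by simp),
    nonnegIndex_sub_sq (seqForm_zero A), seqHodge_eq_nonnegIndex]

theorem seqHodge_singleton_zero : seqHodge [0] = 1 := by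
  have h0 : ∀ v, seqForm [0] v = 0 := fun v => by simp [seqForm]
  rw [seqHodge_eq_nonnegIndex]
  refine le_antisymm (nonnegIndex_le fun W _ => ?_) ?_
  · simpa using W.finrank_le
  · simpa using finrank_le_nonnegIndex (Q := seqForm [0]) ⊤ (fun v _ => (h0 v).ge)

theorem seqForm_le_neg_headCoord_sq {A : List ℤ} (hA : ∀ x ∈ A, x ≤ -2)
    (v : Fin A.length → ℝ) :
    seqForm A v ≤ -headCoord v ^ 2 ∧ (0 ≤ seqForm A v → v = 0) := by
  induction A with
  | nil => exact ⟨by simp [seqForm_nil, headCoord], fun _ => funext fun i => i.elim0⟩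
  | cons x l ih =>
    obtain ⟨h1, h2⟩ := ih (fun y hy => hA y (List.mem_cons_of_mem _ hy)) (Fin.tail v)
    have hx : (x : ℝ) ≤ -2 := by exact_mod_cast hA x List.mem_cons_self
    have hv := seqForm_cons x l v
    set s := (v : Fin (l.length + 1) → ℝ) 0
    have hk : headCoord v = s := rfl
    have key : seqForm (x :: l) v ≤ -s ^ 2 := by
      rw [hv]
      nlinarith [sq_nonneg (s - headCoord (Fin.tail v)), sq_nonneg s]
    refine ⟨by rw [hk]; exact key, fun h => ?_⟩
    have s0 : s = 0 := by
      have : s ^ 2 = 0 := le_antisymm (by linarith) (sq_nonneg s)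
      exact pow_eq_zero_iff two_ne_zero |>.1 this
    rw [hv, s0] at h
    have ht := h2 (by linarith)
    change (v : Fin (l.length + 1) → ℝ) = 0
    funext i
    refine Fin.cases s0 (fun i => congrFun ht i) i

theorem seqHodge_eq_zero {A : List ℤ} (hA : ∀ x ∈ A, x ≤ -2) : seqHodge A = 0 := by
  rw [seqHodge_eq_nonnegIndex]
  refine Nat.le_zero.1 (nonnegIndex_le fun W hW => ?_)
  have : W = ⊥ := (Submodule.eq_bot_iff W).2 fun v hv =>
    (seqForm_le_neg_headCoord_sq hA v).2 (hW v hv)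
  simp [this]

end Form

section Equivalence

theorem SeqBlowup.seqEquiv {X Y : List ℤ} (h : SeqBlowup X Y) : SeqEquiv X Y := .rel _ _ h

theorem SeqEquiv.refl (X : List ℤ) : SeqEquiv X X := Relation.EqvGen.refl X

theorem SeqEquiv.symm {X Y : List ℤ} (h : SeqEquiv X Y) : SeqEquiv Y X :=
  Relation.EqvGen.symm _ _ h

theorem SeqEquiv.trans {X Y Z : List ℤ} (h : SeqEquiv X Y) (h' : SeqEquiv Y Z) : SeqEquiv X Z :=
  Relation.EqvGen.trans _ _ _ h h'

theorem SeqEquiv.invariants {L L' : List ℤ} (h : SeqEquiv L L') :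
    seqHodge L = seqHodge L' ∧ seqDet L = seqDet L' ∧
      seqDet1 L ≡ seqDet1 L' [ZMOD seqDet L] ∧
      seqDet1 L.reverse ≡ seqDet1 L'.reverse [ZMOD seqDet L] := by
  induction h with
  | rel X Y h => exact ⟨h.seqHodge_eq, h.seqDet_eq.1, h.seqDet_eq.2, h.seqDet1_reverse_modEq⟩
  | refl X => exact ⟨rfl, rfl, rfl, rfl⟩
  | symm X Y _ ih => exact ⟨ih.1.symm, ih.2.1.symm, ih.2.1 ▸ ih.2.2.1.symm, ih.2.1 ▸ ih.2.2.2.symm⟩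
  | trans X Y Z _ _ ih₁ ih₂ =>
    obtain ⟨h₁, d₁, a₁, b₁⟩ := ih₁
    obtain ⟨h₂, d₂, a₂, b₂⟩ := ih₂
    rw [← d₁] at d₂ a₂ b₂
    exact ⟨h₁.trans h₂, d₂, a₁.trans a₂, b₁.trans b₂⟩

theorem SeqBlowup.mid_eq {X Y A B : List ℤ} {a b a' b' : ℤ} (hX : X = A ++ a :: b :: B)
    (hY : Y = A ++ a' :: -1 :: b' :: B) (ha : a' = a - 1) (hb : b' = b - 1) :
    SeqBlowup X Y := by
  subst hX hY ha hb
  exact .mid A B a b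

/-- Moving one unit across a zero. -/
theorem seqEquiv_zero_shift_one (A B : List ℤ) (a b : ℤ) :
    SeqEquiv (A ++ a :: 0 :: b :: B) (A ++ (a + 1) :: 0 :: (b - 1) :: B) := by
  have h₁ : SeqBlowup (A ++ a :: 0 :: b :: B) (A ++ a :: -1 :: -1 :: (b - 1) :: B) :=
    SeqBlowup.mid_eq (A := A ++ [a]) (B := B) (a := 0) (b := b) (a' := -1)
      (by simp) (by simp) (by simp) rfl
  have h₂ : SeqBlowup (A ++ (a + 1) :: 0 :: (b - 1) :: B) (A ++ a :: -1 :: -1 :: (b - 1) :: B) :=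
    SeqBlowup.mid_eq (A := A) (a := a + 1) (b := 0) rfl rfl (by simp) (by simp)
  exact h₁.seqEquiv.trans h₂.seqEquiv.symm

theorem seqEquiv_zero_left_one (b : ℤ) (B : List ℤ) :
    SeqEquiv (0 :: b :: B) (0 :: (b - 1) :: B) := by
  have h₁ : SeqBlowup (0 :: b :: B) (-1 :: -1 :: (b - 1) :: B) :=
    SeqBlowup.mid_eq (A := []) rfl rfl (by simp) rfl
  have h₂ : SeqBlowup (0 :: (b - 1) :: B) (-1 :: -1 :: (b - 1) :: B) := by
    simpa using SeqBlowup.left 0 ((b - 1) :: B)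
  exact h₁.seqEquiv.trans h₂.seqEquiv.symm

theorem seqEquiv_zero_right_one (A : List ℤ) (a : ℤ) :
    SeqEquiv (A ++ [a, 0]) (A ++ [a - 1, 0]) := by
  have h₁ : SeqBlowup (A ++ [a, 0]) (A ++ [a - 1, -1, -1]) :=
    SeqBlowup.mid_eq (A := A) (B := []) rfl rfl rfl (by simp)
  have h₂ : SeqBlowup (A ++ [a - 1, 0]) (A ++ [a - 1, -1, -1]) := by
    simpa using SeqBlowup.right (A ++ [a - 1]) 0
  exact h₁.seqEquiv.trans h₂.seqEquiv.symm

/-- A `ℤ`-indexed family with equivalent consecutive terms consists of equivalent terms. -/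
theorem seqEquiv_of_forall_sub_one {F : ℤ → List ℤ} (h : ∀ n, SeqEquiv (F n) (F (n - 1)))
    (m n : ℤ) : SeqEquiv (F m) (F n) := by
  have key : ∀ n, SeqEquiv (F n) (F 0) := fun n => by
    induction n using Int.induction_on with
    | zero => exact .refl _
    | succ i ih => exact SeqEquiv.trans (by simpa using h (i + 1)) ih
    | pred i ih => exact (h (-i)).symm.trans ih
  exact (key m).trans (key n).symm

theorem seqEquiv_zero_shift (A B : List ℤ) (a b : ℤ) :
    SeqEquiv (A ++ a :: 0 :: b :: B) (A ++ 0 :: 0 :: (b + a) :: B) := by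
  have := seqEquiv_of_forall_sub_one (F := fun n => A ++ n :: 0 :: (b + a - n) :: B)
    (fun n => (by
      have := seqEquiv_zero_shift_one A B (n - 1) (b + a - (n - 1))
      rw [show n - 1 + 1 = n by ring, show b + a - (n - 1) - 1 = b + a - n by ring] at this
      exact this.symm)) a 0
  simpa using this

theorem seqEquiv_zero_left (b : ℤ) (B : List ℤ) : SeqEquiv (0 :: b :: B) (0 :: 0 :: B) :=
  seqEquiv_of_forall_sub_one (F := fun n => 0 :: n :: B) (fun n => seqEquiv_zero_left_one n B) b 0

theorem seqEquiv_zero_right (A : List ℤ) (a : ℤ) : SeqEquiv (A ++ [a, 0]) (A ++ [0, 0]) :=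
  seqEquiv_of_forall_sub_one (F := fun n => A ++ [n, 0])
    (fun n => seqEquiv_zero_right_one A n) a 0

theorem SeqBlowup.zero_zero {X Y : List ℤ} (h : SeqBlowup X Y) :
    SeqEquiv (0 :: 0 :: X) (0 :: 0 :: Y) := by
  cases h with
  | empty =>
    refine (seqEquiv_zero_left 1 []).symm.trans (SeqBlowup.seqEquiv ?_)
    simpa using SeqBlowup.right [0] 1
  | left x l =>
    refine (seqEquiv_zero_left 1 (x :: l)).symm.trans (SeqBlowup.seqEquiv ?_)
    simpa using SeqBlowup.mid [0] l 1 x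
  | mid A B a b => exact (SeqBlowup.mid (0 :: 0 :: A) B a b).seqEquiv
  | right l x => exact (SeqBlowup.right (0 :: 0 :: l) x).seqEquiv

theorem SeqEquiv.zero_zero {X Y : List ℤ} (h : SeqEquiv X Y) :
    SeqEquiv (0 :: 0 :: X) (0 :: 0 :: Y) := by
  induction h with
  | rel X Y h => exact h.zero_zero
  | refl X => exact .refl _
  | symm X Y _ ih => exact ih.symm
  | trans X Y Z _ _ ih₁ ih₂ => exact ih₁.trans ih₂

theorem seqEquiv_of_zero_mem (B C : List ℤ) :
    SeqEquiv (B ++ 0 :: C) [0] ∨ ∃ A, SeqEquiv (B ++ 0 :: C) (0 :: 0 :: A) := by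
  induction B using List.reverseRecOn generalizing C with
  | nil =>
    cases C with
    | nil => exact .inl (.refl _)
    | cons c C => exact .inr ⟨C, seqEquiv_zero_left c C⟩
  | append_singleton B a ih =>
    have h : ∃ D, SeqEquiv (B ++ [a] ++ 0 :: C) (B ++ 0 :: D) := by
      cases C with
      | nil => exact ⟨[0], by simpa using seqEquiv_zero_right B a⟩
      | cons c C => exact ⟨0 :: (c + a) :: C, by simpa using seqEquiv_zero_shift B C a c⟩
    obtain ⟨D, hD⟩ := h
    exact (ih D).imp hD.trans fun ⟨A, hA⟩ => ⟨A, hD.trans hA⟩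

theorem exists_seqEquiv_sub_one (B C : List ℤ) (c : ℤ) :
    ∃ D, SeqEquiv (B ++ c :: C) (B ++ (c - 1) :: D) := by
  cases C with
  | nil => exact ⟨[-1], (SeqBlowup.right B c).seqEquiv⟩
  | cons d C => exact ⟨-1 :: (d - 1) :: C, (SeqBlowup.mid B C c d).seqEquiv⟩

theorem seqEquiv_of_nonneg_mem (B C : List ℤ) (n : ℕ) :
    SeqEquiv (B ++ (n : ℤ) :: C) [0] ∨ ∃ A, SeqEquiv (B ++ (n : ℤ) :: C) (0 :: 0 :: A) := by
  induction n generalizing C with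
  | zero => exact seqEquiv_of_zero_mem B C
  | succ n ih =>
    obtain ⟨D, hD⟩ := exists_seqEquiv_sub_one B C (n + 1 : ℕ)
    rw [Nat.cast_succ, add_sub_cancel_right] at hD
    exact (ih D).imp hD.trans fun ⟨A, hA⟩ => ⟨A, hD.trans hA⟩

theorem exists_seqBlowup_of_neg_one (B C : List ℤ) :
    ∃ X, SeqBlowup X (B ++ -1 :: C) := by
  cases B using List.reverseRecOn with
  | nil =>
    cases C with
    | nil => exact ⟨[], .empty⟩
    | cons c C => exact ⟨(c + 1) :: C, by simpa using SeqBlowup.left (c + 1) C⟩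
  | append_singleton B b =>
    cases C with
    | nil => exact ⟨B ++ [b + 1], by simpa using SeqBlowup.right B (b + 1)⟩
    | cons c C =>
      exact ⟨B ++ (b + 1) :: (c + 1) :: C, by simpa using SeqBlowup.mid B C (b + 1) (c + 1)⟩

theorem SeqBlowup.length_eq {X Y : List ℤ} (h : SeqBlowup X Y) : Y.length = X.length + 1 := by
  cases h <;> simp; omega

/-- Every sequence is equivalent to one with all terms at most `-2`, to `(0)`, or to
one that starts with `0, 0`. -/
theorem exists_seqEquiv_normal (L : List ℤ) :
    (∃ A, SeqEquiv L A ∧ ∀ x ∈ A, x ≤ -2) ∨ SeqEquiv L [0] ∨ ∃ A, SeqEquiv L (0 :: 0 :: A) := by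
  induction hn : L.length using Nat.strong_induction_on generalizing L with
  | _ n ih =>
    by_cases hpos : ∃ x ∈ L, 0 ≤ x
    · obtain ⟨x, hx, h0⟩ := hpos
      obtain ⟨B, C, rfl⟩ := List.append_of_mem hx
      lift x to ℕ using h0
      exact .inr (seqEquiv_of_nonneg_mem B C x)
    by_cases hneg : -1 ∈ L
    · obtain ⟨B, C, rfl⟩ := List.append_of_mem hneg
      obtain ⟨X, hX⟩ := exists_seqBlowup_of_neg_one B C
      have hlen := hX.length_eq
      have hXL := hX.seqEquiv.symm
      exact (ih X.length (by omega) X rfl).imp (fun ⟨A, hA, hA'⟩ => ⟨A, hXL.trans hA, hA'⟩)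
        (Or.imp hXL.trans fun ⟨A, hA⟩ => ⟨A, hXL.trans hA⟩)
    · refine .inl ⟨L, .refl L, fun x hx => ?_⟩
      have h0 : ¬0 ≤ x := fun h => hpos ⟨x, hx, h⟩
      have h1 : x ≠ -1 := fun h => hneg (h ▸ hx)
      omega

theorem eq_of_seqDet_modEq {A B : List ℤ} (hA : ∀ x ∈ A, x ≤ -2) (hB : ∀ x ∈ B, x ≤ -2)
    (h : seqDet A = seqDet B) (h₁ : seqDet1 A ≡ seqDet1 B [ZMOD seqDet A]) : A = B := by
  obtain ⟨a₀, a₁⟩ := seqDet1_lt_seqDet hA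
  obtain ⟨b₀, b₁⟩ := seqDet1_lt_seqDet hB
  refine eq_of_seqDet_eq hA hB h ?_
  rw [← Int.emod_eq_of_lt a₀ a₁, ← Int.emod_eq_of_lt b₀ b₁, ← h]
  exact h₁

theorem seqEquiv_singleton_zero {L : List ℤ} (hL : seqHodge L = 1) (hd : seqDet L = 0) :
    SeqEquiv L [0] := by
  obtain ⟨A, hA, hA'⟩ | h | ⟨A, hA⟩ := exists_seqEquiv_normal L
  · have := hA.invariants.1
    rw [seqHodge_eq_zero hA'] at this
    omega
  · exact h
  · obtain ⟨h₀, h₁, -⟩ := hA.invariants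
    rw [seqHodge_zero_zero] at h₀
    rw [(seqDet_zero_zero A).1] at h₁
    obtain ⟨B, hB, hB'⟩ | h | ⟨B, hB⟩ := exists_seqEquiv_normal A
    · have := hB.invariants.2.1
      have := seqDet1_lt_seqDet hB'
      omega
    · have := h.invariants.1
      rw [seqHodge_singleton_zero] at this
      omega
    · have := hB.invariants.1
      rw [seqHodge_zero_zero] at this
      omega

theorem seqEquiv_of_invariants (n : ℕ) {L L' : List ℤ} (hn : seqHodge L = n)
    (hn' : seqHodge L' = n) (hd : seqDet L = seqDet L')
    (h₁ : seqDet1 L ≡ seqDet1 L' [ZMOD seqDet L])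
    (h₂ : seqDet1 L.reverse ≡ seqDet1 L'.reverse [ZMOD seqDet L]) : SeqEquiv L L' := by
  induction n generalizing L L' with
  | zero =>
    have key : ∀ X, seqHodge X = 0 → ∃ A, SeqEquiv X A ∧ ∀ x ∈ A, x ≤ -2 := fun X hX => by
      obtain h | h | ⟨A, hA⟩ := exists_seqEquiv_normal X
      · exact h
      · have := h.invariants.1
        rw [seqHodge_singleton_zero] at this
        omega
      · have := hA.invariants.1
        rw [seqHodge_zero_zero] at this
        omega
    obtain ⟨A, hA, hA'⟩ := key L hn
    obtain ⟨B, hB, hB'⟩ := key L' hn'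
    obtain ⟨-, dA, iA, -⟩ := hA.invariants
    obtain ⟨-, dB, iB, -⟩ := hB.invariants
    rw [← hd] at iB
    have hAB : A = B := eq_of_seqDet_modEq hA' hB' (by omega)
      (dA ▸ iA.symm.trans (h₁.trans iB))
    exact hA.trans (hAB ▸ hB.symm)
  | succ n ih =>
    have key : ∀ X, seqHodge X = n + 1 → SeqEquiv X [0] ∨ ∃ A, SeqEquiv X (0 :: 0 :: A) :=
      fun X hX => by
        obtain ⟨A, hA, hA'⟩ | h := exists_seqEquiv_normal X
        · have := hA.invariants.1
          rw [seqHodge_eq_zero hA'] at this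
          omega
        · exact h
    have single : ∀ X Y, seqHodge X = n + 1 → seqHodge Y = n + 1 → seqDet X = seqDet Y →
        SeqEquiv X [0] → SeqEquiv X Y := fun X Y hX hY hXY h => by
      obtain ⟨e₀, e₁, -⟩ := h.invariants
      rw [seqHodge_singleton_zero] at e₀
      exact h.trans (seqEquiv_singleton_zero (by omega) (by rw [← hXY, e₁]; rfl)).symm
    obtain h | ⟨A, hA⟩ := key L hn
    · exact single L L' hn hn' hd h
    obtain h | ⟨B, hB⟩ := key L' hn'
    · exact (single L' L hn' hn hd.symm h).symm
    obtain ⟨nA, dA, iA, jA⟩ := hA.invariants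
    obtain ⟨nB, dB, iB, jB⟩ := hB.invariants
    obtain ⟨eA, fA, gA⟩ := seqDet_zero_zero A
    obtain ⟨eB, fB, gB⟩ := seqDet_zero_zero B
    rw [seqHodge_zero_zero] at nA nB
    rw [← hd] at iB jB
    have hi := iA.symm.trans (h₁.trans iB)
    have hj := jA.symm.trans (h₂.trans jB)
    rw [dA, eA, Int.modEq_neg] at hi hj
    rw [fA, fB, Int.neg_modEq_neg] at hi
    rw [gA, gB, Int.neg_modEq_neg] at hj
    exact hA.trans ((ih (by omega) (by omega) (by omega) hi hj).zero_zero.trans hB.symm)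

end Equivalence

/-- **Classification of sequences by invariants.** `L ~ L'` iff `hodge(L) = hodge(L')`,
`det(L) = det(L')` and `Subbar(L) = Subbar(L')` (i.e. `det₁` of the sequences and of
their reversals agree modulo `d = det(L)`). -/
theorem seqEquiv_iff_invariants (L L' : List ℤ) :
    SeqEquiv L L' ↔
      (seqHodge L = seqHodge L' ∧ seqDet L = seqDet L' ∧
       seqDet1 L ≡ seqDet1 L' [ZMOD seqDet L] ∧
       seqDet1 L.reverse ≡ seqDet1 L'.reverse [ZMOD seqDet L]) := by
  exact ⟨SeqEquiv.invariants, fun ⟨h, hd, h₁, h₂⟩ => seqEquiv_of_invariants _ h rfl hd h₁ h₂⟩
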